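/- Let n ≥ 1, let N be a 1-unconditional norm on ℝⁿ, and let X₁, …, Xₙ be nonzero Banach spaces each having the Daugavet property. Let X be the product Π_{i} X_i equipped with a complete norm satisfying ‖x‖ = N(i ↦ ‖x_i‖) for all x. Then X has the Daugavet property if and only if for every a ∈ ℝⁿ with a ≥ 0 coordinatewise and N(a) = 1 and every a* ∈ ℝⁿ with a* ≥ 0 coordinatewise and dual norm N*(a*) = 1, there exists b ∈ ℝⁿ with N(b) = 1, Σ_i a*_i b_i = 1 and N(a + b) = 2. -/

import Mathlib

/-- A Banach space `X` has the *Daugavet property* if every rank-one operator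
`z ↦ f z • y` (with `f ≠ 0`, `y ≠ 0`) satisfies `‖Id + T‖ = 1 + ‖T‖`. -/
def DaugavetProperty (X : Type*) [NormedAddCommGroup X] [NormedSpace ℝ X] : Prop :=
  ∀ (f : X →L[ℝ] ℝ) (y : X), f ≠ 0 → y ≠ 0 →
    ‖ContinuousLinearMap.id ℝ X + f.smulRight y‖ = 1 + ‖f.smulRight y‖

section Slices

variable {X : Type*} [NormedAddCommGroup X] [NormedSpace ℝ X]

/-- In a space with the Daugavet property every slice of the unit ball contains points that are
almost diametrically opposite to `-y`. -/
theorem DaugavetProperty.exists_mem_slice (hX : DaugavetProperty X) {f : X →L[ℝ] ℝ}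
    (hf : ‖f‖ = 1) (y : X) {ε : ℝ} (hε : 0 < ε) :
    ∃ x : X, ‖x‖ ≤ 1 ∧ 1 - ε < f x ∧ 1 + ‖y‖ - ε < ‖x + y‖ := by
  have hf0 : f ≠ 0 := by
    rintro rfl
    simp at hf
  rcases eq_or_ne y 0 with rfl | hy
  · obtain ⟨x, hx, hfx⟩ := f.exists_lt_apply_of_lt_opNorm (r := 1 - ε) (by linarith)
    have key : ∀ z : X, ‖z‖ < 1 → 1 - ε < f z →
        ∃ x : X, ‖x‖ ≤ 1 ∧ 1 - ε < f x ∧ 1 + ‖(0 : X)‖ - ε < ‖x + 0‖ := by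
      intro z hz hfz
      refine ⟨z, hz.le, hfz, ?_⟩
      have := f.le_opNorm z
      rw [hf, one_mul, Real.norm_eq_abs] at this
      have := le_abs_self (f z)
      simp only [norm_zero, add_zero]
      linarith
    rcases le_total 0 (f x) with h | h
    · rw [Real.norm_of_nonneg h] at hfx
      exact key x hx hfx
    · rw [Real.norm_of_nonpos h] at hfx
      exact key (-x) (by simpa using hx) (by simpa using hfx)
  have hy' : 0 < ‖y‖ := norm_pos_iff.2 hy
  set δ : ℝ := min (ε / 2) (ε * ‖y‖) with hδ
  have hδ0 : 0 < δ := lt_min (by positivity) (by positivity)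
  have hδ1 : δ ≤ ε / 2 := min_le_left _ _
  have hδ2 : δ ≤ ε * ‖y‖ := min_le_right _ _
  have hnorm := hX f y hf0 hy
  rw [ContinuousLinearMap.norm_smulRight_apply, hf, one_mul] at hnorm
  obtain ⟨x, hx, hlt⟩ := (ContinuousLinearMap.id ℝ X + f.smulRight y).exists_lt_apply_of_lt_opNorm
    (r := 1 + ‖y‖ - δ) (by linarith)
  simp only [add_apply, ContinuousLinearMap.coe_id', id_eq,
    ContinuousLinearMap.smulRight_apply] at hlt
  have key : ∀ z : X, ‖z‖ < 1 → 0 ≤ f z → 1 + ‖y‖ - δ < ‖z + f z • y‖ →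
      ∃ x : X, ‖x‖ ≤ 1 ∧ 1 - ε < f x ∧ 1 + ‖y‖ - ε < ‖x + y‖ := by
    intro z hz hfz hzy
    have h1 : f z ≤ 1 := by
      have := f.le_opNorm z
      rw [hf, one_mul, Real.norm_eq_abs] at this
      have := le_abs_self (f z)
      linarith
    have h2 : ‖z + f z • y‖ ≤ ‖z‖ + f z * ‖y‖ := by
      refine (norm_add_le _ _).trans ?_
      rw [norm_smul, Real.norm_of_nonneg hfz]
    have h3 : ‖z + f z • y‖ ≤ ‖z + y‖ + (1 - f z) * ‖y‖ := by
      have : z + f z • y = (z + y) - (1 - f z) • y := by module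
      rw [this]
      refine (norm_sub_le _ _).trans ?_
      rw [norm_smul, Real.norm_of_nonneg (by linarith)]
    refine ⟨z, hz.le, ?_, by linarith⟩
    by_contra! hcon
    have := mul_le_mul_of_nonneg_right hcon hy'.le
    linarith
  rcases le_total 0 (f x) with h | h
  · exact key x hx h hlt
  · refine key (-x) (by simpa using hx) (by simpa using h) ?_
    have : -x + f (-x) • y = -(x + f x • y) := by
      rw [map_neg]
      module
    rwa [this, norm_neg]

/-- The slice condition on unit functionals and unit vectors implies the Daugavet property. -/
theorem DaugavetProperty.of_exists_mem_slice
    (h : ∀ (f : X →L[ℝ] ℝ) (y : X), ‖f‖ = 1 → ‖y‖ = 1 → ∀ ε : ℝ, 0 < ε →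
      ∃ x : X, ‖x‖ ≤ 1 ∧ 1 - ε < f x ∧ 2 - ε < ‖x + y‖) :
    DaugavetProperty X := by
  intro f y hf hy
  have hf' : 0 < ‖f‖ := norm_pos_iff.2 hf
  have hy' : 0 < ‖y‖ := norm_pos_iff.2 hy
  refine le_antisymm ((norm_add_le _ _).trans
    (by gcongr; exact ContinuousLinearMap.norm_id_le)) ?_
  rw [ContinuousLinearMap.norm_smulRight_apply]
  set c := ‖f‖ * ‖y‖ with hc
  have hc0 : 0 < c := by positivity
  refine le_of_forall_pos_sub_le fun η hη => ?_
  set ε := η / (2 * c + 1) with hε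
  have hε0 : 0 < ε := by positivity
  have hεη : ε * (2 * c + 1) = η := by
    rw [hε]
    field_simp
  obtain ⟨x, hx, hfx, hxy⟩ := h (‖f‖⁻¹ • f) (‖y‖⁻¹ • y)
    (by rw [norm_smul, norm_inv, norm_norm, inv_mul_cancel₀ hf'.ne'])
    (by rw [norm_smul, norm_inv, norm_norm, inv_mul_cancel₀ hy'.ne']) ε hε0
  have hy1 : ‖‖y‖⁻¹ • y‖ = 1 := by
    rw [norm_smul, norm_inv, norm_norm, inv_mul_cancel₀ hy'.ne']
  set u := ‖y‖⁻¹ • y with hu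
  set t := (‖f‖⁻¹ • f) x with ht
  have ht1 : t ≤ 1 := by
    have h1 := (‖f‖⁻¹ • f).le_opNorm x
    rw [norm_smul, norm_inv, norm_norm, inv_mul_cancel₀ hf'.ne', one_mul, Real.norm_eq_abs] at h1
    exact (le_abs_self _).trans (h1.trans hx)
  have hfy : f x • y = (c * t) • u := by
    have : f x = ‖f‖ * t := by
      rw [ht]
      simp [hf'.ne']
    rw [this, hu, smul_smul, hc]
    congr 1
    field_simp
  have happ : ‖x + (c * t) • u‖ ≤ ‖ContinuousLinearMap.id ℝ X + f.smulRight y‖ := by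
    have := (ContinuousLinearMap.id ℝ X + f.smulRight y).unit_le_opNorm x hx
    simpa [hfy] using this
  have hcu : 1 + c - (1 + c) * ε ≤ ‖x + c • u‖ := by
    rcases le_total c 1 with h1 | h1
    · have : ‖x + u‖ ≤ ‖x + c • u‖ + (1 - c) := by
        have e1 : x + u = (x + c • u) + (1 - c) • u := by module
        rw [e1]
        refine (norm_add_le _ _).trans ?_
        rw [norm_smul, hy1, mul_one, Real.norm_of_nonneg (by linarith)]
      nlinarith
    · have : c * ‖x + u‖ ≤ ‖x + c • u‖ + (c - 1) := by
        have e1 : c • (x + u) = (x + c • u) + (c - 1) • x := by module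
        rw [← Real.norm_of_nonneg hc0.le, ← norm_smul, Real.norm_of_nonneg hc0.le, e1]
        refine (norm_add_le _ _).trans ?_
        rw [norm_smul, Real.norm_of_nonneg (by linarith : 0 ≤ c - 1)]
        nlinarith
      nlinarith
  have hct : ‖x + c • u‖ ≤ ‖x + (c * t) • u‖ + c * ε := by
    have e1 : x + c • u = (x + (c * t) • u) + (c * (1 - t)) • u := by module
    rw [e1]
    refine (norm_add_le _ _).trans ?_
    rw [norm_smul, hy1, mul_one, Real.norm_of_nonneg (mul_nonneg hc0.le (by linarith))]
    gcongr
    linarith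
  linarith

/-- A rescaled version of `DaugavetProperty.exists_mem_slice` that also allows `f = 0`. -/
theorem DaugavetProperty.exists_norm_le [Nontrivial X] (hX : DaugavetProperty X) (f : X →L[ℝ] ℝ)
    (y : X) {s : ℝ} (hs : 0 ≤ s) {ε : ℝ} (hε : 0 < ε) :
    ∃ x : X, ‖x‖ ≤ s ∧ s * ‖f‖ - ε ≤ f x ∧ s + ‖y‖ - ε ≤ ‖x + y‖ := by
  obtain ⟨g, hg, hfg⟩ : ∃ g : X →L[ℝ] ℝ, ‖g‖ = 1 ∧ f = ‖f‖ • g := by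
    rcases eq_or_ne f 0 with rfl | hf
    · obtain ⟨g, hg, -⟩ := exists_dual_vector' ℝ (0 : X)
      exact ⟨g, hg, by simp⟩
    · have hf' := norm_ne_zero_iff.2 hf
      exact ⟨‖f‖⁻¹ • f, by rw [norm_smul, norm_inv, norm_norm, inv_mul_cancel₀ hf'],
        by rw [smul_inv_smul₀ hf']⟩
  rcases hs.eq_or_lt with rfl | hs
  · exact ⟨0, by simp, by simpa using hε.le, by simpa using hε.le⟩
  set δ := ε / (s * (‖f‖ + 1)) with hδ
  have hδ0 : 0 < δ := by positivity
  have hδε : s * δ * (‖f‖ + 1) = ε := by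
    rw [hδ]
    field_simp
  obtain ⟨x, hx, hgx, hxy⟩ := hX.exists_mem_slice hg (s⁻¹ • y) hδ0
  have hsd : 0 < s * δ := by positivity
  refine ⟨s • x, ?_, ?_, ?_⟩
  · rw [norm_smul, Real.norm_of_nonneg hs.le]
    nlinarith
  · have : f (s • x) = s * ‖f‖ * g x := by
      conv_lhs => rw [hfg]
      simp
      ring
    rw [this]
    have := mul_le_mul_of_nonneg_left hgx.le (mul_nonneg hs.le (norm_nonneg f))
    nlinarith
  · have e1 : s • x + y = s • (x + s⁻¹ • y) := by rw [smul_add, smul_inv_smul₀ hs.ne']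
    have e2 : ‖s⁻¹ • y‖ = s⁻¹ * ‖y‖ := by
      rw [norm_smul, Real.norm_of_nonneg (inv_nonneg.2 hs.le)]
    rw [e1, norm_smul, Real.norm_of_nonneg hs.le]
    rw [e2] at hxy
    have h1 := mul_le_mul_of_nonneg_left hxy.le hs.le
    have h2 : s * (1 + s⁻¹ * ‖y‖ - δ) = s + ‖y‖ - s * δ := by field_simp
    nlinarith [norm_nonneg f]

end Slices

section Unconditional

variable {ι : Type*} [DecidableEq ι] {N : Seminorm ℝ (ι → ℝ)}

/-- Shrinking one coordinate in absolute value decreases a `1`-unconditional seminorm. -/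
theorem Seminorm.update_le_of_unconditional
    (hN : ∀ a : ι → ℝ, N a = N (fun i => |a i|)) (c : ι → ℝ) (i : ι) {r : ℝ} (hr : |r| ≤ |c i|) :
    N (Function.update c i r) ≤ N c := by
  have hflip : N (Function.update c i (-c i)) = N c := by
    rw [hN, hN c]
    congr 1
    ext j
    rcases eq_or_ne j i with rfl | hj
    · simp
    · simp [hj]
  obtain ⟨t, ht, rfl⟩ : ∃ t : ℝ, |t| ≤ 1 ∧ r = t * c i := by
    rcases eq_or_ne (c i) 0 with h | h
    · refine ⟨0, by simp, ?_⟩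
      rw [h, abs_zero, abs_nonpos_iff] at hr
      rw [hr, zero_mul]
    · refine ⟨r / c i, ?_, by field_simp⟩
      rwa [abs_div, div_le_one (abs_pos.2 h)]
  obtain ⟨ht1, ht2⟩ := abs_le.1 ht
  have hconv : Function.update c i (t * c i) =
      ((1 + t) / 2) • c + ((1 - t) / 2) • Function.update c i (-c i) := by
    ext j
    rcases eq_or_ne j i with rfl | hj
    · simp
      ring
    · simp [hj]
      ring
  rw [hconv]
  refine (map_add_le_add N _ _).trans ?_
  rw [map_smul_eq_mul, map_smul_eq_mul, hflip, Real.norm_of_nonneg (by linarith),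
    Real.norm_of_nonneg (by linarith)]
  linarith

variable [Fintype ι]

/-- A `1`-unconditional seminorm is monotone with respect to coordinatewise absolute values. -/
theorem Seminorm.le_of_abs_le_of_unconditional
    (hN : ∀ a : ι → ℝ, N a = N (fun i => |a i|)) {a b : ι → ℝ} (hab : ∀ i, |a i| ≤ |b i|) :
    N a ≤ N b := by
  suffices h : ∀ s : Finset ι, N (s.piecewise a b) ≤ N b by simpa using h Finset.univ
  intro s
  induction s using Finset.induction_on with
  | empty => simp
  | insert i s hi ih =>
    rw [Finset.piecewise_insert]
    refine (Seminorm.update_le_of_unconditional hN _ i ?_).trans ih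
    simpa [hi] using hab i

theorem Seminorm.abs_mul_single_le_of_unconditional
    (hN : ∀ a : ι → ℝ, N a = N (fun i => |a i|)) (b : ι → ℝ) (i : ι) :
    |b i| * N (Pi.single i 1) ≤ N b := by
  rw [← Real.norm_eq_abs, ← map_smul_eq_mul]
  refine Seminorm.le_of_abs_le_of_unconditional hN fun j => ?_
  rcases eq_or_ne j i with rfl | hj
  · simp
  · simp [hj]

theorem Seminorm.continuous_of_unconditional
    (hN : ∀ a : ι → ℝ, N a = N (fun i => |a i|)) : Continuous N := by
  refine (LipschitzWith.of_le_add_mul (N 1).toNNReal fun x y => ?_).continuous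
  rw [Real.coe_toNNReal _ (apply_nonneg N 1), dist_eq_norm]
  have h1 : N x ≤ N y + N (x - y) := by
    simpa using map_add_le_add N y (x - y)
  have h2 : N (x - y) ≤ N (‖x - y‖ • (1 : ι → ℝ)) := by
    refine Seminorm.le_of_abs_le_of_unconditional hN fun i => ?_
    simpa using norm_le_pi_norm (x - y) i
  rw [map_smul_eq_mul, norm_norm] at h2
  linarith

theorem Seminorm.isCompact_closedBall_of_unconditional (hdef : ∀ a : ι → ℝ, N a = 0 → a = 0)
    (hN : ∀ a : ι → ℝ, N a = N (fun i => |a i|)) : IsCompact {b : ι → ℝ | N b ≤ 1} := by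
  refine (isCompact_univ_pi fun i =>
    isCompact_Icc (a := -(N (Pi.single i 1))⁻¹) (b := (N (Pi.single i 1))⁻¹)).of_isClosed_subset
    (isClosed_le (Seminorm.continuous_of_unconditional hN) continuous_const) fun b hb i _ => ?_
  have hpos : 0 < N (Pi.single i 1) :=
    (apply_nonneg N _).lt_of_ne' fun h => by simpa using hdef _ h
  rw [Set.mem_Icc, ← abs_le, ← one_div, le_div_iff₀ hpos]
  exact (Seminorm.abs_mul_single_le_of_unconditional hN b i).trans hb

end Unconditional

section UnconditionalSum

variable {ι : Type*} [DecidableEq ι] {N : Seminorm ℝ (ι → ℝ)}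
  {X : ι → Type*} [∀ i, NormedAddCommGroup (X i)] [∀ i, NormedSpace ℝ (X i)]
  {V : Type*} [NormedAddCommGroup V] [NormedSpace ℝ V] {e : V ≃ₗ[ℝ] (∀ i, X i)}

/-- The canonical inclusion of a summand into an `N`-sum. -/
noncomputable def unconditionalSumIncl
    (hnorm : ∀ v : V, ‖v‖ = N (fun i => ‖e v i‖)) (i : ι) : X i →L[ℝ] V :=
  LinearMap.mkContinuous (e.symm.toLinearMap ∘ₗ LinearMap.single ℝ X i) (N (Pi.single i 1))
    fun x => by
      have : (fun j => ‖(Pi.single i x : ∀ j, X j) j‖) = ‖x‖ • Pi.single i (1 : ℝ) := by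
        ext j
        rcases eq_or_ne j i with rfl | hj
        · simp
        · simp [hj]
      simp [hnorm, this, map_smul_eq_mul, mul_comm]

theorem unconditionalSumIncl_apply
    (hnorm : ∀ v : V, ‖v‖ = N (fun i => ‖e v i‖)) (i : ι) (x : X i) :
    unconditionalSumIncl hnorm i x = e.symm (Pi.single i x) := rfl

variable [Fintype ι]

/-- The canonical projection of an `N`-sum onto a summand. -/
noncomputable def unconditionalSumProj (hdef : ∀ a : ι → ℝ, N a = 0 → a = 0)
    (hN : ∀ a : ι → ℝ, N a = N (fun i => |a i|))
    (hnorm : ∀ v : V, ‖v‖ = N (fun i => ‖e v i‖)) (i : ι) : V →L[ℝ] X i :=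
  LinearMap.mkContinuous (LinearMap.proj i ∘ₗ e.toLinearMap) (N (Pi.single i 1))⁻¹
    fun v => by
      have hpos : 0 < N (Pi.single i 1) :=
        (apply_nonneg N _).lt_of_ne' fun h => by simpa using hdef _ h
      rw [inv_mul_eq_div, le_div_iff₀ hpos, hnorm]
      simpa using Seminorm.abs_mul_single_le_of_unconditional hN (fun i => ‖e v i‖) i

theorem unconditionalSumProj_apply (hdef : ∀ a : ι → ℝ, N a = 0 → a = 0)
    (hN : ∀ a : ι → ℝ, N a = N (fun i => |a i|))
    (hnorm : ∀ v : V, ‖v‖ = N (fun i => ‖e v i‖)) (i : ι) (v : V) :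
    unconditionalSumProj hdef hN hnorm i v = e v i := rfl

theorem apply_eq_sum_comp_unconditionalSumIncl
    (hnorm : ∀ v : V, ‖v‖ = N (fun i => ‖e v i‖)) (f : V →L[ℝ] ℝ) (v : V) :
    f v = ∑ i, f.comp (unconditionalSumIncl hnorm i) (e v i) := by
  simp only [ContinuousLinearMap.comp_apply, unconditionalSumIncl_apply]
  rw [← map_sum, ← map_sum, Finset.univ_sum_single, e.symm_apply_apply]

theorem sum_norm_comp_unconditionalSumIncl_mul_le
    (hN : ∀ a : ι → ℝ, N a = N (fun i => |a i|))
    (hnorm : ∀ v : V, ‖v‖ = N (fun i => ‖e v i‖)) [∀ i, Nontrivial (X i)]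
    (hX : ∀ i, DaugavetProperty (X i)) (f : V →L[ℝ] ℝ) {b : ι → ℝ} (hb : N b ≤ 1) :
    ∑ i, ‖f.comp (unconditionalSumIncl hnorm i)‖ * b i ≤ ‖f‖ := by
  refine le_of_forall_pos_sub_le fun η hη => ?_
  set ε := η / (Fintype.card ι + 1) with hε
  have hε0 : 0 < ε := by positivity
  have hεη : Fintype.card ι * ε ≤ η := by
    have : (Fintype.card ι + 1) * ε = η := by
      rw [hε]
      field_simp
    linarith
  choose x hx hfx _ using fun i => (hX i).exists_norm_le
    (f.comp (unconditionalSumIncl hnorm i)) 0 (abs_nonneg (b i)) hε0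
  have hxn : ‖e.symm x‖ ≤ 1 := by
    rw [hnorm]
    refine le_trans (Seminorm.le_of_abs_le_of_unconditional hN fun i => ?_) hb
    simpa using hx i
  have hle : ∑ i, (‖f.comp (unconditionalSumIncl hnorm i)‖ * b i - ε) ≤ f (e.symm x) := by
    rw [apply_eq_sum_comp_unconditionalSumIncl hnorm f, e.apply_symm_apply]
    refine Finset.sum_le_sum fun i _ => le_trans ?_ (hfx i)
    rw [mul_comm]
    gcongr
    exact le_abs_self _
  rw [Finset.sum_sub_distrib, Finset.sum_const, Finset.card_univ, nsmul_eq_mul] at hle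
  have hfn := (le_abs_self _).trans (f.unit_le_opNorm _ hxn)
  linarith

/-- The norm of a functional on an `N`-sum is the dual norm of the norms of its components. -/
theorem norm_eq_sSup_unconditionalSum
    (hN : ∀ a : ι → ℝ, N a = N (fun i => |a i|))
    (hnorm : ∀ v : V, ‖v‖ = N (fun i => ‖e v i‖)) [∀ i, Nontrivial (X i)]
    (hX : ∀ i, DaugavetProperty (X i)) (f : V →L[ℝ] ℝ) :
    ‖f‖ = sSup {s : ℝ | ∃ b : ι → ℝ, N b ≤ 1 ∧
      s = ∑ i, ‖f.comp (unconditionalSumIncl hnorm i)‖ * b i} := by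
  have hub : ‖f‖ ∈ upperBounds {s : ℝ | ∃ b : ι → ℝ, N b ≤ 1 ∧
      s = ∑ i, ‖f.comp (unconditionalSumIncl hnorm i)‖ * b i} := by
    rintro s ⟨b, hb, rfl⟩
    exact sum_norm_comp_unconditionalSumIncl_mul_le hN hnorm hX f hb
  have hzero : (0 : ℝ) ∈ {s : ℝ | ∃ b : ι → ℝ, N b ≤ 1 ∧
      s = ∑ i, ‖f.comp (unconditionalSumIncl hnorm i)‖ * b i} := ⟨0, by simp, by simp⟩
  refine le_antisymm (f.opNorm_le_bound (le_csSup ⟨_, hub⟩ hzero) fun v => ?_)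
    (csSup_le ⟨0, hzero⟩ hub)
  rcases eq_or_ne v 0 with rfl | hv
  · simp
  have hv' : 0 < ‖v‖ := norm_pos_iff.2 hv
  rw [← div_le_iff₀ hv']
  refine le_trans ?_ (le_csSup ⟨_, hub⟩ ⟨‖v‖⁻¹ • fun i => ‖e v i‖, ?_, rfl⟩)
  · rw [div_le_iff₀ hv', apply_eq_sum_comp_unconditionalSumIncl hnorm f, Finset.sum_mul]
    refine (norm_sum_le _ _).trans (Finset.sum_le_sum fun i _ => ?_)
    refine ((f.comp (unconditionalSumIncl hnorm i)).le_opNorm _).trans_eq ?_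
    simp only [Pi.smul_apply, smul_eq_mul]
    field_simp
  · rw [map_smul_eq_mul, ← hnorm, norm_inv, norm_norm, inv_mul_cancel₀ hv'.ne']

end UnconditionalSum

/-- Let `N` be a `1`-unconditional norm on `ℝⁿ` and let `X₁, …, Xₙ` be nonzero Banach
spaces with the Daugavet property.  The `N`-sum `X` (the product `Π i, X i` with the
complete norm `‖x‖ = N (i ↦ ‖x i‖)`) has the Daugavet property iff for every positive
`a` with `N a = 1` and every positive `a*` with dual norm `N* (a*) = 1` there is
`b` with `N b = 1`, `∑ i, a*ᵢ bᵢ = 1` and `N (a + b) = 2`. -/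
theorem daugavetProperty_unconditionalSum_iff
    {n : ℕ} (hn : 1 ≤ n) (X : Fin n → Type*)
    [∀ i, NormedAddCommGroup (X i)] [∀ i, NormedSpace ℝ (X i)]
    [∀ i, CompleteSpace (X i)] [∀ i, Nontrivial (X i)]
    (hX : ∀ i, DaugavetProperty (X i))
    (N : Seminorm ℝ (Fin n → ℝ))
    (hNdef : ∀ a : Fin n → ℝ, N a = 0 → a = 0)
    (hNuncond : ∀ a : Fin n → ℝ, N a = N (fun i => |a i|))
    (V : Type*) [NormedAddCommGroup V] [NormedSpace ℝ V] [CompleteSpace V]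
    (e : V ≃ₗ[ℝ] (∀ i, X i))
    (hnorm : ∀ v : V, ‖v‖ = N (fun i => ‖e v i‖)) :
    DaugavetProperty V ↔
      ∀ a : Fin n → ℝ, (∀ i, 0 ≤ a i) → N a = 1 →
        ∀ aStar : Fin n → ℝ, (∀ i, 0 ≤ aStar i) →
          sSup {s : ℝ | ∃ b : Fin n → ℝ, N b ≤ 1 ∧ s = ∑ i, aStar i * b i} = 1 →
          ∃ b : Fin n → ℝ, N b = 1 ∧ (∑ i, aStar i * b i) = 1 ∧ N (a + b) = 2 := by
  constructor
  · intro hV a ha hNa aStar haStar hsup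
    choose u hu using fun i => exists_norm_eq (X i) zero_le_one
    choose g hg _ using fun i => exists_dual_vector' ℝ (0 : X i)
    set f : V →L[ℝ] ℝ :=
      ∑ i, aStar i • (g i).comp (unconditionalSumProj hNdef hNuncond hnorm i) with hf
    have hfv : ∀ v, f v = ∑ i, aStar i * g i (e v i) := fun v => by
      simp [hf, unconditionalSumProj_apply]
    have hcomp : ∀ i, ‖f.comp (unconditionalSumIncl hnorm i)‖ = aStar i := fun i => by
      have : f.comp (unconditionalSumIncl hnorm i) = aStar i • g i := by
        ext x
        rw [ContinuousLinearMap.comp_apply, unconditionalSumIncl_apply, hfv,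
          e.apply_symm_apply, Finset.sum_eq_single i]
        · simp
        · intro j _ hj
          simp [hj]
        · simp
      rw [this, norm_smul, hg, mul_one, Real.norm_of_nonneg (haStar i)]
    have hf1 : ‖f‖ = 1 := by
      rw [norm_eq_sSup_unconditionalSum hNuncond hnorm hX f]
      simpa only [hcomp] using hsup
    set y : V := e.symm fun i => a i • u i with hy
    have hey : ∀ i, e y i = a i • u i := fun i => by rw [hy, e.apply_symm_apply]
    have hyn : ‖y‖ = 1 := by
      rw [hnorm, ← hNa]
      congr 1
      ext i
      rw [hey, norm_smul, hu, mul_one, Real.norm_of_nonneg (ha i)]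
    have hNcont := Seminorm.continuous_of_unconditional hNuncond
    have happrox : ∀ ε : ℝ, 0 < ε → ∃ b : Fin n → ℝ, N b ≤ 1 ∧
        1 + 2 - 2 * ε ≤ (∑ i, aStar i * b i) + N (a + b) := by
      intro ε hε
      obtain ⟨x, hx, hfx, hxy⟩ := hV.exists_mem_slice hf1 y hε
      refine ⟨fun i => ‖e x i‖, hnorm x ▸ hx, ?_⟩
      have h1 : f x ≤ ∑ i, aStar i * ‖e x i‖ := by
        rw [hfv]
        refine Finset.sum_le_sum fun i _ => mul_le_mul_of_nonneg_left ?_ (haStar i)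
        have := (g i).le_opNorm (e x i)
        rw [hg, one_mul] at this
        exact (le_abs_self _).trans this
      have h2 : ‖x + y‖ ≤ N (a + fun i => ‖e x i‖) := by
        rw [hnorm]
        refine Seminorm.le_of_abs_le_of_unconditional hNuncond fun i => ?_
        rw [abs_norm, map_add, Pi.add_apply, Pi.add_apply,
          abs_of_nonneg (by have := ha i; positivity), add_comm (a i)]
        refine (norm_add_le _ _).trans_eq ?_
        rw [hey, norm_smul, hu, mul_one, Real.norm_of_nonneg (ha i)]
      linarith
    obtain ⟨b, hb, hmax⟩ := (Seminorm.isCompact_closedBall_of_unconditional hNdef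
      hNuncond).exists_isMaxOn ⟨0, by simp⟩
      (f := fun b : Fin n → ℝ => (∑ i, aStar i * b i) + N (a + b)) (by fun_prop)
    have h3 : 1 + 2 ≤ (∑ i, aStar i * b i) + N (a + b) := by
      refine le_of_forall_pos_sub_le fun ε hε => ?_
      obtain ⟨c, hc, hle⟩ := happrox (ε / 2) (by positivity)
      have : (∑ i, aStar i * c i) + N (a + c) ≤ (∑ i, aStar i * b i) + N (a + b) := hmax hc
      linarith
    have hb1 : N b ≤ 1 := hb
    have hsum : ∑ i, aStar i * b i ≤ 1 := by
      simpa only [hcomp, hf1] using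
        sum_norm_comp_unconditionalSumIncl_mul_le hNuncond hnorm hX f hb1
    have hadd : N (a + b) ≤ N a + N b := map_add_le_add N a b
    exact ⟨b, by linarith, by linarith, by linarith⟩
  · intro h
    refine DaugavetProperty.of_exists_mem_slice fun f y hf hy ε hε => ?_
    obtain ⟨b, hNb, hsum, hab⟩ := h (fun i => ‖e y i‖) (fun i => norm_nonneg _)
      (by rw [← hnorm, hy]) (fun i => ‖f.comp (unconditionalSumIncl hnorm i)‖)
      (fun i => norm_nonneg _)
      (by rw [← norm_eq_sSup_unconditionalSum hNuncond hnorm hX f, hf])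
    obtain ⟨δ, hδ, hδn, hδN⟩ : ∃ δ : ℝ, 0 < δ ∧ n * δ < ε ∧ δ * N 1 < ε := by
      have hN1 := apply_nonneg N 1
      refine ⟨ε / (n + N 1 + 1), by positivity, ?_, ?_⟩
      · rw [mul_div_assoc', div_lt_iff₀ (by positivity)]
        nlinarith
      · rw [div_mul_eq_mul_div, div_lt_iff₀ (by positivity)]
        nlinarith [(Nat.cast_nonneg n : (0 : ℝ) ≤ n)]
    choose x hx hfx hxy using fun i => (hX i).exists_norm_le
      (f.comp (unconditionalSumIncl hnorm i)) (e y i) (abs_nonneg (b i)) hδ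
    refine ⟨e.symm x, ?_, ?_, ?_⟩
    · rw [hnorm, ← hNb]
      refine Seminorm.le_of_abs_le_of_unconditional hNuncond fun i => ?_
      simpa using hx i
    · have hle : ∑ i, (‖f.comp (unconditionalSumIncl hnorm i)‖ * b i - δ) ≤ f (e.symm x) := by
        rw [apply_eq_sum_comp_unconditionalSumIncl hnorm f, e.apply_symm_apply]
        refine Finset.sum_le_sum fun i _ => le_trans ?_ (hfx i)
        rw [mul_comm]
        gcongr
        exact le_abs_self _
      rw [Finset.sum_sub_distrib, hsum, Finset.sum_const, Finset.card_univ, Fintype.card_fin,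
        nsmul_eq_mul] at hle
      linarith
    · have h1 : N ((fun i => ‖e y i‖) + b) ≤
          N ((fun i => ‖e (e.symm x + y) i‖) + δ • (1 : Fin n → ℝ)) := by
        refine Seminorm.le_of_abs_le_of_unconditional hNuncond fun i => ?_
        have h2 : |‖e y i‖ + b i| ≤ ‖e y i‖ + |b i| := by
          simpa using abs_add_le ‖e y i‖ (b i)
        refine h2.trans (le_trans ?_ (le_abs_self _))
        simp only [map_add, e.apply_symm_apply, Pi.add_apply, Pi.smul_apply, Pi.one_apply,
          smul_eq_mul, mul_one]
        linarith [hxy i]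
      have h3 := h1.trans (map_add_le_add N _ _)
      rw [← hnorm, map_smul_eq_mul, Real.norm_of_nonneg hδ.le, hab] at h3
      linarith
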